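/- arXiv:1310.2151 — 3 statements merged into one kernel-verified Lean document; each statement's English description precedes it below -/
import Mathlib

section
/- Let G be a finite group, p a prime number, and ρ a finite-dimensional irreducible complex representation of G whose dimension is not divisible by p. Then every element g of G which lies both in the commutator subgroup of G and in the center of G, and whose order is a power of p, lies in the kernel of ρ; that is, ρ(g) is the identity. -/
/-- A representation with no proper nonzero invariant subspace over an algebraically closed
field sends central elements to scalars. -/
theorem Representation.exists_eq_smul_one_of_mem_center {k G V : Type*} [Field k] [IsAlgClosed k]
    [Group G] [AddCommGroup V] [Module k V] [FiniteDimensional k V] [Nontrivial V]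
    (ρ : Representation k G V)
    (hirr : ∀ W : Submodule k V, (∀ g : G, ∀ v ∈ W, ρ g v ∈ W) → W = ⊥ ∨ W = ⊤)
    {g : G} (hg : g ∈ Subgroup.center G) : ∃ c : k, ρ g = c • 1 := by
  obtain ⟨c, hc⟩ := Module.End.exists_eigenvalue (ρ g)
  refine ⟨c, ?_⟩
  have htop : Module.End.eigenspace (ρ g) c = ⊤ := by
    refine (hirr _ fun h v hv => ?_).resolve_left hc
    rw [Module.End.mem_eigenspace_iff] at hv ⊢
    rw [← Module.End.mul_apply, ← map_mul, ← Subgroup.mem_center_iff.mp hg h, map_mul,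
      Module.End.mul_apply, hv, map_smul]
  ext v
  exact Module.End.mem_eigenspace_iff.mp (htop ▸ Submodule.mem_top : v ∈ _)

/-- A representation has determinant one on the commutator subgroup. -/
theorem Representation.det_eq_one_of_mem_commutator {k G V : Type*} [CommRing k]
    [Group G] [AddCommGroup V] [Module k V] (ρ : Representation k G V)
    {g : G} (hg : g ∈ commutator G) : LinearMap.det (ρ g) = 1 := by
  have h := Abelianization.commutator_subset_ker
    (MonoidHom.toHomUnits ((LinearMap.det : (V →ₗ[k] V) →* k).comp ρ)) hg
  exact congrArg Units.val (MonoidHom.mem_ker.mp h)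

/-- If `ρ` is an irreducible complex representation of a finite group `G` of dimension
prime to `p`, then every central commutator `p`-element of `G` is in the kernel of `ρ`. -/
theorem central_commutator_p_element_in_kernel
    (G : Type) [Group G] [Finite G] (p : ℕ) (hp : p.Prime)
    (V : Type) [AddCommGroup V] [Module ℂ V] [FiniteDimensional ℂ V] [Nontrivial V]
    (ρ : Representation ℂ G V)
    (hirr : ∀ W : Submodule ℂ V, (∀ g : G, ∀ v ∈ W, ρ g v ∈ W) → W = ⊥ ∨ W = ⊤)
    (hdim : ¬ p ∣ Module.finrank ℂ V)
    (g : G) (hg1 : g ∈ commutator G) (hg2 : g ∈ Subgroup.center G)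
    (hg3 : ∃ k : ℕ, orderOf g = p ^ k) :
    ρ g = 1 := by
  obtain ⟨c, hc⟩ := ρ.exists_eq_smul_one_of_mem_center hirr hg2
  obtain ⟨k, hk⟩ := hg3
  have hdet : c ^ Module.finrank ℂ V = 1 := by
    simpa [hc, LinearMap.det_smul] using ρ.det_eq_one_of_mem_commutator hg1
  have hpow : c ^ p ^ k = 1 := by
    have h : (c • 1 : Module.End ℂ V) ^ p ^ k = 1 := by
      rw [← hc, ← map_pow, ← hk, pow_orderOf_eq_one, map_one]
    obtain ⟨v, hv⟩ := exists_ne (0 : V)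
    have hv' : c ^ p ^ k • v = (1 : ℂ) • v := by
      simpa [smul_pow] using LinearMap.congr_fun h v
    exact smul_left_injective ℂ hv hv'
  have hcop : (p ^ k).Coprime (Module.finrank ℂ V) :=
    ((Nat.Prime.coprime_iff_not_dvd hp).mpr hdim).pow_left k
  have hc1 : c = 1 := by
    simpa [hcop.gcd_eq_one] using pow_gcd_eq_one.mpr ⟨hpow, hdet⟩
  rw [hc, hc1, one_smul]
end

section
/- For every integer n ≥ 4, every finite-dimensional irreducible complex representation of the double cover Ã_n of the alternating group whose dimension is odd sends the central element z to the identity. (Equivalently: Ã_n has no spin characters of odd degree.) -/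
/-- Relations defining the double cover `S̃ₙ` of the symmetric group:
generators are `none = z` and `some i = tᵢ` for `i : Fin (n-1)`, with relations
`z² = 1`, `tᵢ² = z`, `(tᵢ tᵢ₊₁)³ = z` and `(tᵢ tⱼ)² = z` for `|i - j| ≥ 2`. -/
def spinRels (n : ℕ) : Set (FreeGroup (Option (Fin (n - 1)))) :=
  {r | r = FreeGroup.of (none : Option (Fin (n - 1))) ^ 2}
  ∪ {r | ∃ i : Fin (n - 1), r = FreeGroup.of (some i) ^ 2 * (FreeGroup.of none)⁻¹}
  ∪ {r | ∃ i j : Fin (n - 1), (j : ℕ) = (i : ℕ) + 1 ∧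
      r = (FreeGroup.of (some i) * FreeGroup.of (some j)) ^ 3 * (FreeGroup.of none)⁻¹}
  ∪ {r | ∃ i j : Fin (n - 1), ((i : ℕ) + 2 ≤ (j : ℕ) ∨ (j : ℕ) + 2 ≤ (i : ℕ)) ∧
      r = (FreeGroup.of (some i) * FreeGroup.of (some j)) ^ 2 * (FreeGroup.of none)⁻¹}

/-- The double cover `S̃ₙ` of the symmetric group, as a presented group. -/
abbrev SpinSym (n : ℕ) : Type := PresentedGroup (spinRels n)

/-- The central element `z` of `S̃ₙ`. -/
def spinZ (n : ℕ) : SpinSym n := PresentedGroup.of none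

/-- The generator `tᵢ` of `S̃ₙ`. -/
def spinT (n : ℕ) (i : Fin (n - 1)) : SpinSym n := PresentedGroup.of (some i)

/-- The `i`-th point of `Fin n`, for `i : Fin (n-1)`. -/
def finL {n : ℕ} (i : Fin (n - 1)) : Fin n := ⟨(i : ℕ), by have := i.2; omega⟩

/-- The `(i+1)`-st point of `Fin n`, for `i : Fin (n-1)`. -/
def finR {n : ℕ} (i : Fin (n - 1)) : Fin n := ⟨(i : ℕ) + 1, by have := i.2; omega⟩

/-- `π : S̃ₙ → Sₙ` is the canonical projection iff `π z = 1` and `π tᵢ` is the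
transposition of the `i`-th and `(i+1)`-st points. -/
def IsSpinProj (n : ℕ) (π : SpinSym n →* Equiv.Perm (Fin n)) : Prop :=
  π (spinZ n) = 1 ∧ ∀ i : Fin (n - 1), π (spinT n i) = Equiv.swap (finL i) (finR i)

/-- The double cover `Ãₙ = π⁻¹(Aₙ)` of the alternating group, as a subgroup of `S̃ₙ`. -/
def SpinAlt (n : ℕ) (π : SpinSym n →* Equiv.Perm (Fin n)) : Subgroup (SpinSym n) :=
  (alternatingGroup (Fin n)).comap π

/-- The central element `z`, as an element of `Ãₙ`. -/
def spinZA (n : ℕ) (π : SpinSym n →* Equiv.Perm (Fin n)) (hπ : IsSpinProj n π) :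
    ↥(SpinAlt n π) :=
  ⟨spinZ n, Subgroup.mem_comap.mpr (by rw [hπ.1]; exact Subgroup.one_mem _)⟩

/-- In a group satisfying the relations of `S̃₄`, the lifts `a c` and `b a c b⁻¹` of the double
transpositions `(1 2)(3 4)` and `(1 3)(2 4)` commute up to `z`. -/
theorem spin_double_transpositions_anticommute {G : Type*} [Group G] {a b c z : G}
    (hz : z ^ 2 = 1) (ha : a ^ 2 = z) (hb : b ^ 2 = z) (hc : c ^ 2 = z)
    (hab : (a * b) ^ 3 = z) (hbc : (b * c) ^ 3 = z) (hac : (a * c) ^ 2 = z) :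
    (a * c) * (b * a * c * b⁻¹) = z * ((b * a * c * b⁻¹) * (a * c)) := by
  have hza : a * z = z * a := by rw [← ha]; group
  have hzb : b * z = z * b := by rw [← hb]; group
  have hzc : c * z = z * c := by rw [← hc]; group
  have hzi : z⁻¹ = z := inv_eq_of_mul_eq_one_left (by rw [← sq, hz])
  have inv_of_sq {x : G} (hx : x ^ 2 = z) : x⁻¹ = z * x := by
    rw [← hzi, ← hx]; group
  have hzz : z * z = 1 := by rw [← sq, hz]
  have hzz' (x : G) : z * (z * x) = x := by rw [← mul_assoc, hzz, one_mul]
  have hza' (x : G) : a * (z * x) = z * (a * x) := by rw [← mul_assoc, hza, mul_assoc]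
  have hzb' (x : G) : b * (z * x) = z * (b * x) := by rw [← mul_assoc, hzb, mul_assoc]
  have hzc' (x : G) : c * (z * x) = z * (c * x) := by rw [← mul_assoc, hzc, mul_assoc]
  have braid {x y : G} (hx : x ^ 2 = z) (hy : y ^ 2 = z) (hxz : x * z = z * x)
      (hxy : (x * y) ^ 3 = z) : x * (y * x) = y * (x * y) := by
    have hyz : y * z = z * y := by rw [← hy]; group
    have h : x * (y * x) = z * (y⁻¹ * (x⁻¹ * y⁻¹)) := by
      rw [← hxy]; simp only [pow_succ, pow_zero, one_mul]; group
    rw [h, inv_of_sq hx, inv_of_sq hy]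
    calc z * (z * y * (z * x * (z * y)))
        = z * z * (y * z) * (x * z) * y := by group
      _ = z * z * z * y * z * x * y := by rw [hyz, hxz]; group
      _ = z * z * z * (y * z) * x * y := by group
      _ = (z * z) * (z * z) * (y * (x * y)) := by rw [hyz]; group
      _ = y * (x * y) := by rw [hzz]; group
  have b1 := braid ha hb hza hab
  have b2 := braid hb hc hzb hbc
  have hca : c * a = z * (a * c) := by
    have h : c * a = a⁻¹ * (z * c⁻¹) := by rw [← hac]; simp only [sq]; group
    rw [h, inv_of_sq ha, inv_of_sq hc, hzz', mul_assoc]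
  have h5 : a * (c * (b * (a * c))) = z * (a * (b * (c * (b * a)))) := by
    have hac' : a * c = z * (c * a) := by rw [hca, hzz']
    have b2' : c * (b * (c * a)) = b * (c * (b * a)) := by
      simpa only [mul_assoc] using congrArg (· * a) b2.symm
    rw [hac', hzb', hzc', hza', b2']
  have hL : a * (c * (b * (a * (c * b)))) = a * (b * (a * (c * (b * a)))) := by
    calc a * (c * (b * (a * (c * b))))
        = a * (c * (b * (a * c))) * b := by group
      _ = z * (a * (b * (c * (b * (a * b))))) := by rw [h5]; group
      _ = z * (a * (b * ((c * a) * (b * a)))) := by rw [← b1]; group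
      _ = a * (b * (a * (c * (b * a)))) := by
        rw [hca, mul_assoc, mul_assoc, hzb', hza', hzz']
  have hR : b * (a * (c * (b * (a * c)))) = z * (a * (b * (a * (c * (b * a))))) := by
    calc b * (a * (c * (b * (a * c))))
        = z * (b * (a * b) * (c * (b * a))) := by rw [h5, hzb']; group
      _ = z * (a * (b * (a * (c * (b * a))))) := by rw [← b1]; group
  rw [inv_of_sq hb]
  simp only [mul_assoc, hza', hzb', hzc']
  rw [hL, hR, hzz']

theorem spinZ_sq (n : ℕ) : spinZ n ^ 2 = 1 :=
  PresentedGroup.one_of_mem (rels := spinRels n) (x := FreeGroup.of none ^ 2)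
    (Or.inl <| Or.inl <| Or.inl rfl)

theorem spinT_sq (n : ℕ) (i : Fin (n - 1)) : spinT n i ^ 2 = spinZ n :=
  mul_inv_eq_one.1 <| PresentedGroup.one_of_mem (rels := spinRels n)
    (x := FreeGroup.of (some i) ^ 2 * (FreeGroup.of none)⁻¹)
    (Or.inl <| Or.inl <| Or.inr ⟨i, rfl⟩)

theorem spinT_mul_spinT_succ_pow_three (n : ℕ) {i j : Fin (n - 1)} (h : (j : ℕ) = (i : ℕ) + 1) :
    (spinT n i * spinT n j) ^ 3 = spinZ n :=
  mul_inv_eq_one.1 <| PresentedGroup.one_of_mem (rels := spinRels n)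
    (x := (FreeGroup.of (some i) * FreeGroup.of (some j)) ^ 3 * (FreeGroup.of none)⁻¹)
    (Or.inl <| Or.inr ⟨i, j, h, rfl⟩)

theorem spinT_mul_spinT_sq (n : ℕ) {i j : Fin (n - 1)} (h : (i : ℕ) + 2 ≤ (j : ℕ)) :
    (spinT n i * spinT n j) ^ 2 = spinZ n :=
  mul_inv_eq_one.1 <| PresentedGroup.one_of_mem (rels := spinRels n)
    (x := (FreeGroup.of (some i) * FreeGroup.of (some j)) ^ 2 * (FreeGroup.of none)⁻¹)
    (Or.inr ⟨i, j, Or.inl h, rfl⟩)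

theorem spinZ_mem_center (n : ℕ) : spinZ n ∈ Subgroup.center (SpinSym n) := by
  rw [Subgroup.mem_center_iff]
  suffices h : (⊤ : Subgroup (SpinSym n)) ≤ Subgroup.centralizer {spinZ n} from fun g ↦
    (Subgroup.mem_centralizer_singleton_iff.1 (h (Subgroup.mem_top g)))
  rw [← PresentedGroup.closure_range_of, Subgroup.closure_le]
  rintro _ ⟨_ | i, rfl⟩
  · exact Subgroup.mem_centralizer_singleton_iff.2 rfl
  · refine Subgroup.mem_centralizer_singleton_iff.2 ?_
    change spinT n i * spinZ n = spinZ n * spinT n i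
    rw [← spinT_sq n i]
    group

theorem sign_spinT {n : ℕ} {π : SpinSym n →* Equiv.Perm (Fin n)} (hπ : IsSpinProj n π)
    (i : Fin (n - 1)) : Equiv.Perm.sign (π (spinT n i)) = -1 := by
  rw [hπ.2, Equiv.Perm.sign_swap]
  simp [finL, finR, Fin.ext_iff]

/-- `Ãₙ` (`n ≥ 4`) contains two elements which commute up to `z`. -/
theorem exists_spinAlt_anticommute {n : ℕ} (hn : 4 ≤ n)
    (π : SpinSym n →* Equiv.Perm (Fin n)) (hπ : IsSpinProj n π) :
    ∃ x y : SpinAlt n π, x * y = spinZA n π hπ * (y * x) := by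
  let a := spinT n ⟨0, by omega⟩
  let b := spinT n ⟨1, by omega⟩
  let c := spinT n ⟨2, by omega⟩
  refine ⟨⟨a * c, ?_⟩, ⟨b * a * c * b⁻¹, ?_⟩, Subtype.ext ?_⟩
  · simp [SpinAlt, a, c, Equiv.Perm.mem_alternatingGroup, sign_spinT hπ]
  · simp [SpinAlt, a, b, c, Equiv.Perm.mem_alternatingGroup, sign_spinT hπ]
  · exact spin_double_transpositions_anticommute (spinZ_sq n) (spinT_sq n _) (spinT_sq n _)
      (spinT_sq n _) (spinT_mul_spinT_succ_pow_three n rfl)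
      (spinT_mul_spinT_succ_pow_three n rfl) (spinT_mul_spinT_sq n le_rfl)

/-- A central involution acts by `1` or `-1` on an irreducible representation. -/
theorem Representation.apply_eq_one_or_neg_one_of_central_involution {G k V : Type*} [Group G]
    [Field k] [AddCommGroup V] [Module k V] (ρ : Representation k G V)
    (hirr : ∀ W : Submodule k V, (∀ g, ∀ v ∈ W, ρ g v ∈ W) → W = ⊥ ∨ W = ⊤)
    {z : G} (hz : z ^ 2 = 1) (hzc : ∀ g, g * z = z * g) : ρ z = 1 ∨ ρ z = -1 := by
  have hcomm (g : G) (v : V) : ρ z (ρ g v) = ρ g (ρ z v) := by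
    rw [← Module.End.mul_apply, ← map_mul, ← hzc, map_mul, Module.End.mul_apply]
  have hsq (v : V) : ρ z (ρ z v) = v := by
    rw [← Module.End.mul_apply, ← map_mul, ← sq, hz, map_one, Module.End.one_apply]
  rcases hirr (LinearMap.ker (ρ z - 1)) (fun g v hv ↦ by
    rw [LinearMap.mem_ker, LinearMap.sub_apply, sub_eq_zero] at hv ⊢
    simp only [Module.End.one_apply] at hv ⊢
    rw [hcomm, hv]) with h | h
  · right
    ext v
    have hv : v + ρ z v ∈ LinearMap.ker (ρ z - 1) := by
      simp [hsq, add_comm]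
    rw [h, Submodule.mem_bot] at hv
    simpa using eq_neg_of_add_eq_zero_right hv
  · left
    exact sub_eq_zero.1 (LinearMap.ker_eq_top.1 h)

/-- `Ãₙ` (`n ≥ 4`) has no spin characters of odd degree: every odd-dimensional
irreducible complex representation of `Ãₙ` sends `z` to the identity. -/
theorem spinAlt_no_odd_degree_spin_char (n : ℕ) (hn : 4 ≤ n)
    (π : SpinSym n →* Equiv.Perm (Fin n)) (hπ : IsSpinProj n π)
    (V : Type) [AddCommGroup V] [Module ℂ V] [FiniteDimensional ℂ V] [Nontrivial V]
    (ρ : Representation ℂ ↥(SpinAlt n π) V)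
    (hirr : ∀ W : Submodule ℂ V, (∀ g : ↥(SpinAlt n π), ∀ v ∈ W, ρ g v ∈ W) → W = ⊥ ∨ W = ⊤)
    (hodd : Odd (Module.finrank ℂ V)) :
    ρ (spinZA n π hπ) = 1 := by
  refine (ρ.apply_eq_one_or_neg_one_of_central_involution hirr
    (Subtype.ext (spinZ_sq n)) fun g ↦ Subtype.ext
      (Subgroup.mem_center_iff.1 (spinZ_mem_center n) g)).resolve_right fun hneg ↦ ?_
  obtain ⟨x, y, hxy⟩ := exists_spinAlt_anticommute hn π hπ
  have hdet (g : SpinAlt n π) : LinearMap.det (ρ g) ≠ 0 := fun h ↦ by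
    have h1 : LinearMap.det (ρ g) * LinearMap.det (ρ g⁻¹) = 1 := by
      rw [← map_mul, ← map_mul, mul_inv_cancel, map_one, map_one]
    rw [h, zero_mul] at h1
    exact zero_ne_one h1
  have hneg_det : LinearMap.det (-1 : V →ₗ[ℂ] V) = -1 := by
    rw [← neg_one_smul ℂ (1 : V →ₗ[ℂ] V), LinearMap.det_smul, hodd.neg_one_pow]
    exact (congrArg _ (map_one _)).trans (mul_one _)
  have h := congrArg (fun g ↦ LinearMap.det (ρ g)) hxy
  simp only [map_mul, hneg, hneg_det] at h
  have h0 : LinearMap.det (ρ x) * LinearMap.det (ρ y) = 0 := by linear_combination h / 2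
  exact mul_ne_zero (hdet x) (hdet y) h0
end

section
/- For every integer n ≥ 4, the center of the double cover S̃_n is exactly the subgroup {1, z} generated by the central element z: Subgroup.center (S̃_n) = Subgroup.closure {z}, and this subgroup has order 2. -/
/-- The descending product `s (k + d - 1) * ⋯ * s (k + 1) * s k`. -/
def descProd {Q : Type*} [Monoid Q] (s : ℕ → Q) (k : ℕ) : ℕ → Q
  | 0 => 1
  | d + 1 => s (k + d) * descProd s k d

theorem descProd_succ_left {Q : Type*} [Monoid Q] (s : ℕ → Q) (k d : ℕ) :
    descProd s k (d + 1) = descProd s (k + 1) d * s k := by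
  induction d with
  | zero => simp [descProd]
  | succ d ih =>
    rw [descProd, ih, descProd, mul_assoc]
    congr 2
    omega

/-- The Coxeter relations of the symmetric group on `n` points, for elements `s i` with
`i + 1 < n`. -/
structure SymmetricRelations {Q : Type*} [Monoid Q] (n : ℕ) (s : ℕ → Q) : Prop where
  sq : ∀ i, i + 1 < n → s i * s i = 1
  braid : ∀ i, i + 2 < n → s i * s (i + 1) * s i = s (i + 1) * s i * s (i + 1)
  comm : ∀ i j, i + 2 ≤ j → j + 1 < n → s i * s j = s j * s i

namespace SymmetricRelations

variable {Q : Type*} [Group Q] {n : ℕ} {s : ℕ → Q}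

theorem descProd_mul_of_lt (hs : SymmetricRelations n s) {j k : ℕ} (hj : j + 1 < k) :
    ∀ d, k + d < n → descProd s k d * s j = s j * descProd s k d
  | 0, _ => by simp [descProd]
  | d + 1, hd => by
    rw [descProd, mul_assoc, descProd_mul_of_lt hs hj d (by omega), ← mul_assoc,
      ← hs.comm j (k + d) (by omega) (by omega), mul_assoc]

theorem descProd_mul_of_gt (hs : SymmetricRelations n s) {j k : ℕ} (hj : j + 1 < n) :
    ∀ d, k + d < j → descProd s k d * s j = s j * descProd s k d
  | 0, _ => by simp [descProd]
  | d + 1, hd => by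
    rw [descProd, mul_assoc, descProd_mul_of_gt hs hj d (by omega), ← mul_assoc,
      hs.comm (k + d) j (by omega) hj, mul_assoc]

theorem descProd_mul_succ (hs : SymmetricRelations n s) {j k : ℕ} (hj : k ≤ j) :
    ∀ d, j + 1 < k + d → k + d < n → descProd s k d * s (j + 1) = s j * descProd s k d
  | 0, h, _ => by omega
  | d + 1, h, hd => by
    rcases Nat.lt_or_ge (j + 1) (k + d) with h1 | h1
    · rw [descProd, mul_assoc, descProd_mul_succ hs hj d h1 (by omega), ← mul_assoc,
        ← hs.comm j (k + d) (by omega) (by omega), mul_assoc]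
    · obtain ⟨e, rfl⟩ : ∃ e, d = e + 1 := ⟨d - 1, by omega⟩
      obtain rfl : j = k + e := by omega
      have h2 := hs.braid (k + e) (by omega)
      have h3 := hs.descProd_mul_of_gt (j := k + e + 1) (k := k) (by omega) e (by omega)
      simp only [descProd, ← add_assoc]
      rw [mul_assoc, mul_assoc, h3, ← mul_assoc, ← mul_assoc, ← h2]
      simp only [mul_assoc]

/-- The subgroup generated by the `s i` with `i + 1 < m`. -/
def initial (s : ℕ → Q) (m : ℕ) : Subgroup Q := Subgroup.closure {x | ∃ i, i + 1 < m ∧ x = s i}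

theorem mem_initial {i m : ℕ} (h : i + 1 < m) : s i ∈ initial s m :=
  Subgroup.subset_closure ⟨i, h, rfl⟩

theorem exists_eq_mul_descProd (hs : SymmetricRelations n s) {m : ℕ} (hm : m < n) {x : Q}
    (hx : x ∈ initial s (m + 1)) :
    ∃ k d, k + d = m ∧ ∃ h ∈ initial s m, x = h * descProd s k d := by
  have step : ∀ j, j + 1 < m + 1 → ∀ x,
      (∃ k d, k + d = m ∧ ∃ h ∈ initial s m, x = h * descProd s k d) →
      ∃ k d, k + d = m ∧ ∃ h ∈ initial s m, x * s j = h * descProd s k d := by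
    rintro j hj _ ⟨k, d, hkd, h, hh, rfl⟩
    rcases lt_trichotomy (j + 1) k with h1 | h1 | h1
    · refine ⟨k, d, hkd, h * s j, mul_mem hh (mem_initial (by omega)), ?_⟩
      rw [mul_assoc, hs.descProd_mul_of_lt h1 d (by omega), mul_assoc]
    · subst h1
      refine ⟨j, d + 1, by omega, h, hh, ?_⟩
      rw [descProd_succ_left, mul_assoc]
    · rcases Nat.lt_or_ge k j with h2 | h2
      · obtain ⟨i, rfl⟩ : ∃ i, j = i + 1 := ⟨j - 1, by omega⟩
        refine ⟨k, d, hkd, h * s i, mul_mem hh (mem_initial (by omega)), ?_⟩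
        rw [mul_assoc, hs.descProd_mul_succ (by omega) d (by omega) (by omega), mul_assoc]
      · obtain rfl : j = k := by omega
        obtain ⟨e, rfl⟩ : ∃ e, d = e + 1 := ⟨d - 1, by omega⟩
        refine ⟨j + 1, e, by omega, h, hh, ?_⟩
        rw [descProd_succ_left, mul_assoc, mul_assoc, hs.sq j (by omega), mul_one]
  induction hx using Subgroup.closure_induction_right with
  | one => exact ⟨m, 0, rfl, 1, one_mem _, by simp [descProd]⟩
  | mul_right x y _ hy ih =>
    obtain ⟨j, hj, rfl⟩ := hy
    exact step j hj x ih
  | mul_inv_cancel x y _ hy ih =>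
    obtain ⟨j, hj, rfl⟩ := hy
    rw [inv_eq_of_mul_eq_one_right (hs.sq j (by omega))]
    exact step j hj x ih

variable {π : Q →* Equiv.Perm ℕ}

theorem map_apply_of_mem_initial (hπ : ∀ i, i + 1 < n → π (s i) = Equiv.swap i (i + 1))
    {m : ℕ} (hm : m < n) {x : Q} (hx : x ∈ initial s m) : π x m = m := by
  have : initial s m ≤ (MulAction.stabilizer (Equiv.Perm ℕ) m).comap π := by
    refine (Subgroup.closure_le _).2 ?_
    rintro _ ⟨i, hi, rfl⟩
    simp only [SetLike.mem_coe, Subgroup.mem_comap, MulAction.mem_stabilizer_iff,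
      Equiv.Perm.smul_def, hπ i (by omega)]
    exact Equiv.swap_apply_of_ne_of_ne (by omega) (by omega)
  exact this hx

theorem map_descProd_apply (hπ : ∀ i, i + 1 < n → π (s i) = Equiv.swap i (i + 1)) (k : ℕ) :
    ∀ d, k + d < n → π (descProd s k d) k = k + d
  | 0, _ => by simp [descProd]
  | d + 1, hd => by
    rw [descProd, map_mul, Equiv.Perm.mul_apply, map_descProd_apply hπ k d (by omega),
      hπ _ (by omega), Equiv.swap_apply_left, add_assoc]

theorem mem_initial_of_map_apply_eq (hs : SymmetricRelations n s)
    (hπ : ∀ i, i + 1 < n → π (s i) = Equiv.swap i (i + 1)) {m : ℕ} (hm : m < n) {x : Q}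
    (hx : x ∈ initial s (m + 1)) (hfix : π x m = m) : x ∈ initial s m := by
  obtain ⟨k, d, hkd, h, hh, rfl⟩ := hs.exists_eq_mul_descProd hm hx
  have h1 : π (h * descProd s k d) k = m := by
    rw [map_mul, Equiv.Perm.mul_apply, map_descProd_apply hπ k d (by omega), hkd,
      map_apply_of_mem_initial hπ hm hh]
  obtain rfl : m = k := (π (h * descProd s k d)).injective (hfix.trans h1.symm)
  obtain rfl : d = 0 := by omega
  simpa [descProd] using hh

theorem eq_one_of_map_apply_eq (hs : SymmetricRelations n s)
    (hπ : ∀ i, i + 1 < n → π (s i) = Equiv.swap i (i + 1)) :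
    ∀ m ≤ n, ∀ x ∈ initial s m, (∀ k < m, π x k = k) → x = 1
  | 0, _, x, hx, _ => by simpa [initial] using hx
  | m + 1, hm, x, hx, hfix =>
    eq_one_of_map_apply_eq hs hπ m (by omega) x
      (hs.mem_initial_of_map_apply_eq hπ (by omega) hx (hfix m (by omega)))
      fun k hk => hfix k (by omega)

end SymmetricRelations

theorem apply_eq_of_commute_swap {n : ℕ} (hn : 3 ≤ n) (σ : Equiv.Perm ℕ)
    (hσ : ∀ i, i + 1 < n → σ * Equiv.swap i (i + 1) = Equiv.swap i (i + 1) * σ) (k : ℕ)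
    (hk : k < n) : σ k = k := by
  have key : ∀ i, i + 1 < n → (σ i = i ∨ σ i = i + 1) ∧ (σ (i + 1) = i ∨ σ (i + 1) = i + 1) := by
    intro i hi
    have h1 := congrArg (fun τ : Equiv.Perm ℕ => τ i) (hσ i hi)
    have h2 : σ (i + 1) ≠ σ i := fun h => by simpa using σ.injective h
    simp only [Equiv.Perm.mul_apply, Equiv.swap_apply_left, Equiv.swap_apply_def] at h1
    split_ifs at h1 <;> omega
  have inj : ∀ a b, σ a = σ b → a = b := fun a b h => σ.injective h
  have mid : ∀ i, i + 2 < n → σ (i + 1) = i + 1 := fun i hi => by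
    have := key i (by omega)
    have := key (i + 1) hi
    omega
  rcases Nat.eq_zero_or_pos k with rfl | h0
  · have h1 := mid 0 (by omega)
    have := key 0 (by omega)
    have := inj 0 (0 + 1)
    omega
  · obtain ⟨i, rfl⟩ : ∃ i, k = i + 1 := ⟨k - 1, by omega⟩
    rcases Nat.lt_or_ge (i + 2) n with h | h
    · exact mid i h
    · obtain ⟨j, rfl⟩ : ∃ j, i = j + 1 := ⟨i - 1, by omega⟩
      have h1 := mid j (by omega)
      have := key (j + 1) (by omega)
      have := inj (j + 1) (j + 1 + 1)
      omega

/-- The homomorphism from the double cover determined by images satisfying its relations. -/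
theorem exists_spinSym_hom {G : Type*} [Group G] (n : ℕ) (z : G) (t : ℕ → G) (hz : z ^ 2 = 1)
    (hsq : ∀ i, i + 1 < n → t i ^ 2 = z)
    (hbraid : ∀ i, i + 2 < n → (t i * t (i + 1)) ^ 3 = z)
    (hcomm : ∀ i j, i + 1 < n → j + 1 < n → i + 2 ≤ j ∨ j + 2 ≤ i → (t i * t j) ^ 2 = z) :
    ∃ f : SpinSym n →* G, f (spinZ n) = z ∧ ∀ i : Fin (n - 1), f (spinT n i) = t i := by
  let g : Option (Fin (n - 1)) → G := fun o => o.elim z fun i => t i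
  have hg : ∀ r ∈ spinRels n, FreeGroup.lift g r = 1 := by
    rintro r (((rfl | ⟨i, rfl⟩) | ⟨i, j, hij, rfl⟩) | ⟨i, j, hij, rfl⟩)
    · simpa [g] using hz
    · simpa [g, mul_inv_eq_one] using hsq i (by omega)
    · simpa [g, mul_inv_eq_one, hij] using hbraid i (by omega)
    · simpa [g, mul_inv_eq_one] using hcomm i j (by omega) (by omega) hij
  exact ⟨PresentedGroup.toGroup hg, PresentedGroup.toGroup.of hg,
    fun i => PresentedGroup.toGroup.of hg⟩

theorem exists_spinSym_hom_perm (n : ℕ) :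
    ∃ f : SpinSym n →* Equiv.Perm ℕ, f (spinZ n) = 1 ∧
      ∀ i, f (spinT n i) = Equiv.swap (i : ℕ) (i + 1) := by
  refine exists_spinSym_hom n (1 : Equiv.Perm ℕ) (fun i => Equiv.swap i (i + 1)) (one_pow 2)
    ?_ ?_ ?_
  · intro i _
    simp [sq]
  · intro i _
    ext x
    simp only [pow_succ, pow_zero, one_mul, Equiv.Perm.mul_apply, Equiv.swap_apply_def,
      Equiv.Perm.one_apply]
    grind
  · intro i j _ _ hij
    ext x
    simp only [sq, Equiv.Perm.mul_apply, Equiv.swap_apply_def, Equiv.Perm.one_apply]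
    grind

theorem spinT_mul_pow_three {n : ℕ} {i j : Fin (n - 1)} (h : (j : ℕ) = i + 1) :
    (spinT n i * spinT n j) ^ 3 = spinZ n :=
  mul_inv_eq_one.1 <|
    PresentedGroup.one_of_mem (rels := spinRels n) (Or.inl (Or.inr ⟨i, j, h, rfl⟩))

theorem spinT_mul_sq {n : ℕ} {i j : Fin (n - 1)} (h : (i : ℕ) + 2 ≤ j) :
    (spinT n i * spinT n j) ^ 2 = spinZ n :=
  mul_inv_eq_one.1 <|
    PresentedGroup.one_of_mem (rels := spinRels n) (Or.inr ⟨i, j, Or.inl h, rfl⟩)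

theorem closure_spinZ_union_spinT (n : ℕ) :
    Subgroup.closure ({spinZ n} ∪ Set.range (spinT n)) = ⊤ := by
  rw [eq_top_iff, ← PresentedGroup.closure_range_of]
  refine Subgroup.closure_mono ?_
  rintro _ ⟨_ | i, rfl⟩
  · exact Or.inl rfl
  · exact Or.inr ⟨i, rfl⟩

theorem pow_three_mul_eq_neg_one_of_add_swap {A : Type*} [Ring A] {v w : A} (hv : v * v = -1)
    (hw : w * w = -1) (h : v * w + w * v = 1) : (v * w) ^ 3 = -1 := by
  have h1 : w * v = 1 - v * w := eq_sub_of_add_eq' h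
  have h2 : (v * w) ^ 2 = v * w - 1 := by
    calc (v * w) ^ 2 = v * (w * v) * w := by noncomm_ring
      _ = v * w - (v * v) * (w * w) := by rw [h1]; noncomm_ring
      _ = v * w - 1 := by rw [hv, hw]; noncomm_ring
  rw [pow_succ, h2, sub_mul, ← sq, h2]
  noncomm_ring

theorem sq_mul_eq_neg_one_of_add_swap {A : Type*} [Ring A] {v w : A} (hv : v * v = -1)
    (hw : w * w = -1) (h : v * w + w * v = 0) : (v * w) ^ 2 = -1 := by
  have h1 : w * v = -(v * w) := eq_neg_of_add_eq_zero_right h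
  calc (v * w) ^ 2 = v * (w * v) * w := by noncomm_ring
    _ = -((v * v) * (w * w)) := by rw [h1]; noncomm_ring
    _ = -1 := by rw [hv, hw]; noncomm_ring

/-- Half the negated standard bilinear form on finitely supported rational sequences. -/
noncomputable def negHalfDot : LinearMap.BilinForm ℚ (ℕ →₀ ℚ) :=
  (-1 / 2 : ℚ) • Finsupp.linearCombination ℚ fun i => (Finsupp.lapply i : (ℕ →₀ ℚ) →ₗ[ℚ] ℚ)

theorem negHalfDot_single_sub (i j : ℕ) :
    negHalfDot (Finsupp.single i 1 - Finsupp.single (i + 1) 1)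
        (Finsupp.single j 1 - Finsupp.single (j + 1) 1) =
      if i = j then -1 else if j = i + 1 ∨ i = j + 1 then 1 / 2 else 0 := by
  simp only [negHalfDot, map_sub, LinearMap.sub_apply, LinearMap.smul_apply,
    Finsupp.linearCombination_single, one_smul, Finsupp.lapply_apply, Finsupp.single_apply,
    smul_eq_mul]
  split_ifs <;> first | omega | norm_num

theorem spinZ_ne_one (n : ℕ) : spinZ n ≠ 1 := by
  let Q := negHalfDot.toQuadraticMap
  let v : ℕ → ℕ →₀ ℚ := fun i => Finsupp.single i 1 - Finsupp.single (i + 1) 1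
  let a : ℕ → CliffordAlgebra Q := fun i => CliffordAlgebra.ι Q (v i)
  have hsq : ∀ i, a i * a i = -1 := fun i => by
    simp only [a, CliffordAlgebra.ι_sq_scalar, Q, LinearMap.BilinMap.toQuadraticMap_apply, v,
      negHalfDot_single_sub, if_true, map_neg, map_one]
  have hswap : ∀ i j, a i * a j + a j * a i =
      algebraMap ℚ _ (negHalfDot (v i) (v j) + negHalfDot (v j) (v i)) := fun i j => by
    simp only [a, CliffordAlgebra.ι_mul_ι_add_swap, Q, LinearMap.BilinMap.polar_toQuadraticMap]
  let t : ℕ → (CliffordAlgebra Q)ˣ := fun i =>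
    ⟨a i, -a i, by rw [mul_neg, hsq, neg_neg], by rw [neg_mul, hsq, neg_neg]⟩
  have ht : ∀ i, (t i : CliffordAlgebra Q) = a i := fun i => rfl
  obtain ⟨f, hf, -⟩ := exists_spinSym_hom n (-1 : (CliffordAlgebra Q)ˣ) t (by simp) (fun i _ => by
      ext
      simpa [ht, sq] using hsq i) (fun i _ => by
      ext
      simp only [Units.val_pow_eq_pow_val, Units.val_mul, ht, Units.val_neg, Units.val_one]
      refine pow_three_mul_eq_neg_one_of_add_swap (hsq _) (hsq _) ?_
      rw [hswap, negHalfDot_single_sub, negHalfDot_single_sub, if_neg (by omega),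
        if_pos (by omega), if_neg (by omega), if_pos (by omega), add_halves, map_one])
    (fun i j _ _ hij => by
      ext
      simp only [Units.val_pow_eq_pow_val, Units.val_mul, ht, Units.val_neg, Units.val_one]
      refine sq_mul_eq_neg_one_of_add_swap (hsq _) (hsq _) ?_
      rw [hswap, negHalfDot_single_sub, negHalfDot_single_sub, if_neg (by omega),
        if_neg (by omega), if_neg (by omega), if_neg (by omega), add_zero, map_zero])
  intro h
  rw [h, map_one] at hf
  have h1 : algebraMap ℚ (CliffordAlgebra Q) (-1) = algebraMap ℚ _ 1 := by
    simpa using (congrArg Units.val hf).symm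
  have h2 := (algebraMap ℚ (CliffordAlgebra Q)).injective h1
  norm_num at h2

theorem center_spinSym_le (n : ℕ) (hn : 4 ≤ n) :
    Subgroup.center (SpinSym n) ≤ Subgroup.closure {spinZ n} := by
  intro x hx
  have hc : Subgroup.closure {spinZ n} ≤ Subgroup.center (SpinSym n) :=
    (Subgroup.closure_le _).2 (by simpa using spinZ_mem_center n)
  have : (Subgroup.closure {spinZ n}).Normal :=
    ⟨fun y hy g => by rwa [Subgroup.mem_center_iff.1 (hc hy) g, mul_inv_cancel_right]⟩
  obtain ⟨f, hfz, hft⟩ := exists_spinSym_hom_perm n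
  let N := Subgroup.closure {spinZ n}
  let q : SpinSym n →* SpinSym n ⧸ N := QuotientGroup.mk' N
  let π : SpinSym n ⧸ N →* Equiv.Perm ℕ :=
    QuotientGroup.lift N f ((Subgroup.closure_le f.ker).2 (by simpa using hfz))
  have hπq : ∀ y, π (q y) = f y := fun y => rfl
  let s : ℕ → SpinSym n ⧸ N := fun i => if h : i < n - 1 then q (spinT n ⟨i, h⟩) else 1
  have hs : ∀ (i : ℕ) (h : i < n - 1), s i = q (spinT n ⟨i, h⟩) := fun i h => dif_pos h
  have hqz : q (spinZ n) = 1 :=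
    (QuotientGroup.eq_one_iff _).2 (Subgroup.subset_closure rfl)
  have hsq : ∀ i, i + 1 < n → s i * s i = 1 := fun i hi => by
    rw [hs i (by omega), ← map_mul, ← sq, spinT_sq, hqz]
  have hinv : ∀ i, i + 1 < n → (s i)⁻¹ = s i := fun i hi => inv_eq_of_mul_eq_one_right (hsq i hi)
  have hrel : SymmetricRelations n s := by
    refine ⟨hsq, fun i hi => ?_, fun i j hij hj => ?_⟩
    · have h : (s i * s (i + 1)) ^ 3 = 1 := by
        rw [hs i (by omega), hs (i + 1) (by omega), ← map_mul, ← map_pow,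
          spinT_mul_pow_three rfl, hqz]
      rw [← mul_inv_eq_one, mul_inv_rev, mul_inv_rev, hinv i (by omega), hinv (i + 1) (by omega),
        ← h]
      simp only [pow_succ, pow_zero, one_mul, mul_assoc]
    · have h : (s i * s j) ^ 2 = 1 := by
        rw [hs i (by omega), hs j (by omega), ← map_mul, ← map_pow, spinT_mul_sq hij, hqz]
      rw [← mul_inv_eq_one, mul_inv_rev, hinv i (by omega), hinv j (by omega), ← h, sq]
  have hπs : ∀ i, i + 1 < n → π (s i) = Equiv.swap i (i + 1) := fun i hi => by
    rw [hs i (by omega), hπq, hft]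
  have htop : ∀ y, q y ∈ SymmetricRelations.initial s n := by
    have h : Subgroup.closure ({spinZ n} ∪ Set.range (spinT n)) ≤
        (SymmetricRelations.initial s n).comap q := by
      refine (Subgroup.closure_le _).2 ?_
      rintro _ (rfl | ⟨i, rfl⟩)
      · simp only [SetLike.mem_coe, Subgroup.mem_comap, hqz, one_mem]
      · simp only [SetLike.mem_coe, Subgroup.mem_comap, ← hs i i.2]
        exact SymmetricRelations.mem_initial (by omega)
    rw [closure_spinZ_union_spinT] at h
    exact fun y => h (Subgroup.mem_top y)
  refine (QuotientGroup.eq_one_iff x).1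
    (hrel.eq_one_of_map_apply_eq hπs n le_rfl (q x) (htop x) fun k hk => ?_)
  refine apply_eq_of_commute_swap (by omega) _ (fun i hi => ?_) k hk
  have h := hft ⟨i, by omega⟩
  simp only at h
  rw [hπq, ← h, ← map_mul, ← map_mul, Subgroup.mem_center_iff.1 hx]

/-- For `n ≥ 4`, the center of `S̃ₙ` is exactly the subgroup `{1, z}` generated by `z`,
and this subgroup has order 2. -/
theorem center_spinSym_eq_closure_z (n : ℕ) (hn : 4 ≤ n) :
    Subgroup.center (SpinSym n) = Subgroup.closure {spinZ n} ∧
      Nat.card ↥(Subgroup.closure {spinZ n}) = 2 := by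
  refine ⟨le_antisymm (center_spinSym_le n hn)
    ((Subgroup.closure_le _).2 (by simpa using spinZ_mem_center n)), ?_⟩
  rw [← Subgroup.zpowers_eq_closure, Nat.card_zpowers]
  exact orderOf_eq_prime (spinZ_sq n) (spinZ_ne_one n)
end
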